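/- Fix κ ∈ (0,1), q ∈ [0,1], w > 0, and a finite Borel measure μ on [0,1] having a continuous, everywhere positive density with respect to Lebesgue measure. If (f*,a*) is a pure-strategy Nash equilibrium, then a₁* > 0 if and only if κ·q > P^{f*,a*}, and a₂* > 0 if and only if κ·(1−q) > 1 − P^{f*,a*}. -/

import Mathlib

open MeasureTheory Set

noncomputable section

/-- `μ` is a finite Borel measure on `[0,1]` with a continuous, everywhere positive
density with respect to Lebesgue measure. -/
def NiceDensity (μ : Measure ℝ) : Prop :=
  ∃ g : ℝ → ℝ, ContinuousOn g (Icc 0 1) ∧ (∀ p ∈ Icc (0:ℝ) 1, 0 < g p) ∧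
    μ = (volume.restrict (Icc (0:ℝ) 1)).withDensity (fun p => ENNReal.ofReal (g p))

/-- Total amount wagered by the diffuse players on Outcome 1. -/
def d1 (μ : Measure ℝ) (f : ℝ → ℝ × ℝ) : ℝ := ∫ p in Icc (0:ℝ) 1, (f p).1 ∂μ

/-- Total amount wagered by the diffuse players on Outcome 2. -/
def d2 (μ : Measure ℝ) (f : ℝ → ℝ × ℝ) : ℝ := ∫ p in Icc (0:ℝ) 1, (f p).2 ∂μ

/-- The implied probability of Outcome 1, `P^{f,a}`. -/
def impliedProb (μ : Measure ℝ) (f : ℝ → ℝ × ℝ) (a : ℝ × ℝ) : ℝ :=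
  (d1 μ f + a.1) / (d1 μ f + d2 μ f + a.1 + a.2)

/-- A feasible strategy profile for the diffuse players. -/
def FeasibleDiffuse (f : ℝ → ℝ × ℝ) : Prop :=
  Measurable f ∧ ∀ p ∈ Icc (0:ℝ) 1, 0 ≤ (f p).1 ∧ 0 ≤ (f p).2 ∧ (f p).1 + (f p).2 ≤ 1

/-- A feasible strategy profile for the atomic player. -/
def FeasibleAtomic (w : ℝ) (a : ℝ × ℝ) : Prop := 0 ≤ a.1 ∧ 0 ≤ a.2 ∧ a.1 + a.2 ≤ w

/-- The expected profit of a bettor who believes Outcome 1 occurs with probability `p`,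
betting `b1` on Outcome 1 and `b2` on Outcome 2, when the implied probability of
Outcome 1 is `P` (with the indicator conventions of the paper). -/
def payoff (κ P p b1 b2 : ℝ) : ℝ :=
  b1 * ((if P = 0 then 0 else κ * p / P) - 1) +
  b2 * ((if P = 1 then 0 else κ * (1 - p) / (1 - P)) - 1)

/-- A pure-strategy Nash equilibrium. -/
def IsEquilibrium (κ q w : ℝ) (μ : Measure ℝ) (f : ℝ → ℝ × ℝ) (a : ℝ × ℝ) : Prop :=
  FeasibleDiffuse f ∧ FeasibleAtomic w a ∧
  0 < d1 μ f + d2 μ f + a.1 + a.2 ∧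
  (∀ p ∈ Icc (0:ℝ) 1,
    payoff κ (impliedProb μ f a) p (f p).1 (f p).2 =
      sSup {x | ∃ b1 b2 : ℝ, 0 ≤ b1 ∧ 0 ≤ b2 ∧ b1 + b2 ≤ 1 ∧
        x = payoff κ (impliedProb μ f a) p b1 b2}) ∧
  payoff κ (impliedProb μ f a) q a.1 a.2 =
    sSup {x | ∃ b1 b2 : ℝ, 0 ≤ b1 ∧ 0 ≤ b2 ∧ b1 + b2 ≤ w ∧
      0 < d1 μ f + d2 μ f + b1 + b2 ∧
      x = payoff κ (impliedProb μ f (b1, b2)) q b1 b2}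

def VV (e1 e2 k1 k2 b1 b2 : ℝ) : ℝ :=
  b1 * (k1 * (e1 + e2 + b1 + b2) / (e1 + b1) - 1) +
  b2 * (k2 * (e1 + e2 + b1 + b2) / (e2 + b2) - 1)

lemma VV_swap (e1 e2 k1 k2 b1 b2 : ℝ) : VV e2 e1 k2 k1 b2 b1 = VV e1 e2 k1 k2 b1 b2 := by
  have : e2 + e1 + b2 + b1 = e1 + e2 + b1 + b2 := by ring
  unfold VV
  rw [this]; ring

lemma VV_le (e1 e2 k1 k2 b1 b2 w : ℝ) (h1 : 0 ≤ e1) (h2 : 0 ≤ e2) (hk1 : 0 ≤ k1) (hk2 : 0 ≤ k2)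
    (hb1 : 0 ≤ b1) (hb2 : 0 ≤ b2) (hw : b1 + b2 ≤ w) :
    VV e1 e2 k1 k2 b1 b2 ≤ (k1 + k2) * (e1 + e2 + w) := by
  have key : ∀ e k b : ℝ, 0 ≤ e → 0 ≤ k → 0 ≤ b →
      b * (k * (e1 + e2 + b1 + b2) / (e + b) - 1) ≤ k * (e1 + e2 + w) := by
    intro e k b he hk hb
    have hT : 0 ≤ k * (e1 + e2 + b1 + b2) := by positivity
    have hf : b / (e + b) ≤ 1 := div_le_one_of_le₀ (by linarith) (by linarith)
    have e1' : b * (k * (e1 + e2 + b1 + b2) / (e + b) - 1)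
        = (b / (e + b)) * (k * (e1 + e2 + b1 + b2)) - b := by ring
    have := mul_le_mul_of_nonneg_right hf hT
    have h3 : k * (e1 + e2 + b1 + b2) ≤ k * (e1 + e2 + w) :=
      mul_le_mul_of_nonneg_left (by linarith) hk
    linarith
  have := key e1 k1 b1 h1 hk1 hb1
  have := key e2 k2 b2 h2 hk2 hb2
  unfold VV
  linarith

lemma VV_diff (e1 e2 k1 k2 a1 a2 x : ℝ) (h1 : 0 ≤ e1) (h2 : 0 ≤ e2)
    (ha1 : 0 < a1) (ha2 : 0 ≤ a2) (hx : 0 < x) :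
    VV e1 e2 k1 k2 x a2 - VV e1 e2 k1 k2 a1 a2 =
      (x - a1) * (k1 * (1 + e1 * (e2 + a2) / ((e1 + a1) * (e1 + x))) - 1
        + a2 * k2 / (e2 + a2)) := by
  have hu : e1 + a1 ≠ 0 := by positivity
  have hv : e1 + x ≠ 0 := by positivity
  unfold VV
  rcases eq_or_lt_of_le ha2 with h | h
  · subst h
    simp only [zero_mul, zero_div, add_zero]
    field_simp
    ring
  · have hc : e2 + a2 ≠ 0 := by positivity
    field_simp
    ring

lemma foc (e1 e2 k1 k2 a1 a2 w : ℝ) (h1 : 0 ≤ e1) (h2 : 0 ≤ e2)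
    (ha1 : 0 < a1) (ha2 : 0 ≤ a2) (hw : a1 + a2 ≤ w)
    (hopt : ∀ b1 b2 : ℝ, 0 ≤ b1 → 0 ≤ b2 → b1 + b2 ≤ w → 0 < e1 + e2 + b1 + b2 →
      VV e1 e2 k1 k2 b1 b2 ≤ VV e1 e2 k1 k2 a1 a2) :
    0 ≤ k1 * (1 + e1 * (e2 + a2) / ((e1 + a1) * (e1 + a1))) - 1 + a2 * k2 / (e2 + a2) := by
  have hu : (e1 + a1) * (e1 + a1) ≠ 0 := by positivity
  have hc : ContinuousAt (fun x : ℝ => k1 * (1 + e1 * (e2 + a2) / ((e1 + a1) * (e1 + x))) - 1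
      + a2 * k2 / (e2 + a2)) a1 := by
    fun_prop (disch := assumption)
  refine ge_of_tendsto (hc.tendsto.mono_left (nhdsWithin_le_nhds (s := Iio a1))) ?_
  filter_upwards [Ioo_mem_nhdsLT ha1] with x hx
  have h3 := hopt x a2 hx.1.le ha2 (by linarith [hx.2]) (by linarith [hx.1])
  have h4 := VV_diff e1 e2 k1 k2 a1 a2 x h1 h2 ha1 ha2 hx.1
  by_contra hneg
  push Not at hneg
  have := mul_pos_of_neg_of_neg (sub_neg.2 hx.2) hneg
  linarith

lemma foc_zero (e2 k1 k2 a1 a2 w : ℝ) (h2 : 0 ≤ e2) (hk2 : 0 ≤ k2) (hk : k1 + k2 < 1)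
    (ha1 : 0 < a1) (ha2 : 0 ≤ a2) (hw : a1 + a2 ≤ w)
    (hopt : ∀ b1 b2 : ℝ, 0 ≤ b1 → 0 ≤ b2 → b1 + b2 ≤ w → 0 < 0 + e2 + b1 + b2 →
      VV 0 e2 k1 k2 b1 b2 ≤ VV 0 e2 k1 k2 a1 a2) : False := by
  have h := foc 0 e2 k1 k2 a1 a2 w le_rfl h2 ha1 ha2 hw hopt
  have hf : a2 / (e2 + a2) ≤ 1 := div_le_one_of_le₀ (by linarith) (by linarith)
  have h3 := mul_le_mul_of_nonneg_right hf hk2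
  have : a2 * k2 / (e2 + a2) = a2 / (e2 + a2) * k2 := by ring
  rw [this] at h
  simp only [zero_mul, zero_div] at h
  linarith

/-- not both positive -/
lemma not_both (e1 e2 k1 k2 a1 a2 w : ℝ) (h1 : 0 < e1) (h2 : 0 < e2)
    (hk : k1 + k2 < 1)
    (ha1 : 0 < a1) (ha2 : 0 < a2) (hw : a1 + a2 ≤ w)
    (hopt : ∀ b1 b2 : ℝ, 0 ≤ b1 → 0 ≤ b2 → b1 + b2 ≤ w → 0 < e1 + e2 + b1 + b2 →
      VV e1 e2 k1 k2 b1 b2 ≤ VV e1 e2 k1 k2 a1 a2) : False := by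
  have f1 := foc e1 e2 k1 k2 a1 a2 w h1.le h2.le ha1 ha2.le hw hopt
  have f2 := foc e2 e1 k2 k1 a2 a1 w h2.le h1.le ha2 ha1.le (by linarith) (by
    intro b1 b2 hb1 hb2 hb hT
    rw [VV_swap e1 e2 k1 k2 b2 b1, VV_swap e1 e2 k1 k2 a1 a2]
    exact hopt b2 b1 hb2 hb1 (by linarith) (by linarith))
  obtain ⟨u, hu⟩ : ∃ u, u = e1 + a1 := ⟨_, rfl⟩
  obtain ⟨v, hv⟩ : ∃ v, v = e2 + a2 := ⟨_, rfl⟩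
  have hu0 : 0 < u := by rw [hu]; positivity
  have hv0 : 0 < v := by rw [hv]; positivity
  rw [← hu, ← hv] at f1 f2
  obtain rfl : a1 = u - e1 := by linarith
  obtain rfl : a2 = v - e2 := by linarith
  have g1 := mul_nonneg hu0.le f1
  have g2 := mul_nonneg hv0.le f2
  have : u * (k1 * (1 + e1 * v / (u * u)) - 1 + (v - e2) * k2 / v) +
      v * (k2 * (1 + e2 * u / (v * v)) - 1 + (u - e1) * k1 / u) = (u + v) * (k1 + k2 - 1) := by
    field_simp
    ring
  have : (u + v) * (k1 + k2 - 1) < 0 := mul_neg_of_pos_of_neg (by positivity) (by linarith)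
  linarith

lemma core_mp (e1 e2 k1 k2 a1 a2 w : ℝ) (h1 : 0 < e1) (h2 : 0 < e2)
    (hk2 : 0 ≤ k2) (hk : k1 + k2 < 1)
    (ha1 : 0 < a1) (ha2 : 0 ≤ a2) (hw : a1 + a2 ≤ w)
    (hopt : ∀ b1 b2 : ℝ, 0 ≤ b1 → 0 ≤ b2 → b1 + b2 ≤ w → 0 < e1 + e2 + b1 + b2 →
      VV e1 e2 k1 k2 b1 b2 ≤ VV e1 e2 k1 k2 a1 a2) :
    e1 + a1 < k1 * (e1 + e2 + a1 + a2) := by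
  rcases eq_or_lt_of_le ha2 with h | h
  · subst h
    have f1 := foc e1 e2 k1 k2 a1 0 w h1.le h2.le ha1 le_rfl hw hopt
    have hu : 0 < e1 + a1 := by positivity
    have g := mul_nonneg (mul_pos hu hu).le f1
    have e : (e1 + a1) * (e1 + a1) * (k1 * (1 + e1 * (e2 + 0) / ((e1 + a1) * (e1 + a1))) - 1
        + 0 * k2 / (e2 + 0)) = k1 * ((e1 + a1) * (e1 + a1) + e1 * e2) - (e1 + a1) * (e1 + a1) := by
      field_simp
      ring
    rw [e] at g
    by_contra hn
    push Not at hn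
    have := mul_le_mul_of_nonneg_left hn h1.le
    have h5 : 0 < (e1 + a1) * a1 * (1 - k1) := by
      have : 0 < 1 - k1 := by linarith
      positivity
    nlinarith
  · exact (not_both e1 e2 k1 k2 a1 a2 w h1 h2 hk ha1 h hw hopt).elim

lemma core (e1 e2 k1 k2 a1 a2 w : ℝ) (h1 : 0 < e1) (h2 : 0 < e2)
    (hk1 : 0 ≤ k1) (hk2 : 0 ≤ k2) (hk : k1 + k2 < 1)
    (ha1 : 0 ≤ a1) (ha2 : 0 ≤ a2) (hw : a1 + a2 ≤ w) (hw0 : 0 < w)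
    (hopt : ∀ b1 b2 : ℝ, 0 ≤ b1 → 0 ≤ b2 → b1 + b2 ≤ w → 0 < e1 + e2 + b1 + b2 →
      VV e1 e2 k1 k2 b1 b2 ≤ VV e1 e2 k1 k2 a1 a2) :
    0 < a1 ↔ e1 + a1 < k1 * (e1 + e2 + a1 + a2) := by
  constructor
  · intro h
    exact core_mp e1 e2 k1 k2 a1 a2 w h1 h2 hk2 hk h ha2 hw hopt
  · intro h
    by_contra hn
    obtain rfl : a1 = 0 := le_antisymm (not_lt.1 hn) ha1
    rcases eq_or_lt_of_le ha2 with h' | h'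
    · subst h'
      simp only [add_zero] at h
      have hk1' : 0 < k1 := by
        rcases eq_or_lt_of_le hk1 with h0 | h0
        · rw [← h0] at h; linarith
        · exact h0
      obtain ⟨ε, hε⟩ : ∃ ε, ε = min w (k1 * (e1 + e2) - e1) := ⟨_, rfl⟩
      have hε0 : 0 < ε := by rw [hε]; exact lt_min hw0 (by linarith)
      have hεw : ε ≤ w := by rw [hε]; exact min_le_left _ _
      have hεk : ε ≤ k1 * (e1 + e2) - e1 := by rw [hε]; exact min_le_right _ _
      have h3 := hopt ε 0 hε0.le le_rfl (by linarith) (by positivity)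
      unfold VV at h3
      simp only [zero_mul, add_zero] at h3
      have h4 : 1 < k1 * (e1 + e2 + ε) / (e1 + ε) := by
        rw [lt_div_iff₀ (by positivity)]
        nlinarith [mul_pos hk1' hε0]
      nlinarith [mul_pos hε0 (sub_pos.2 h4)]
    · have := core_mp e2 e1 k2 k1 a2 0 w h2 h1 hk1 (by linarith) h' le_rfl (by linarith) (by
        intro b1 b2 hb1 hb2 hb hT
        rw [VV_swap e1 e2 k1 k2 b2 b1, VV_swap e1 e2 k1 k2 0 a2]
        exact hopt b2 b1 hb2 hb1 (by linarith) (by linarith))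
      have h5 : 0 < (1 - (k1 + k2)) * (e1 + e2 + a2) := by
        have : 0 < 1 - (k1 + k2) := by linarith
        positivity
      nlinarith

lemma payoff_eq (κ q : ℝ) (μ : Measure ℝ) (f : ℝ → ℝ × ℝ) (b1 b2 : ℝ)
    (hT : 0 < d1 μ f + d2 μ f + b1 + b2) :
    payoff κ (impliedProb μ f (b1, b2)) q b1 b2 =
      VV (d1 μ f) (d2 μ f) (κ * q) (κ * (1 - q)) b1 b2 := by
  have hP : impliedProb μ f (b1, b2) = (d1 μ f + b1) / (d1 μ f + d2 μ f + b1 + b2) := rfl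
  have hP' : 1 - impliedProb μ f (b1, b2) = (d2 μ f + b2) / (d1 μ f + d2 μ f + b1 + b2) := by
    rw [hP]; field_simp; ring
  have i1 : (if impliedProb μ f (b1, b2) = 0 then 0 else κ * q / impliedProb μ f (b1, b2))
      = κ * q / impliedProb μ f (b1, b2) := by
    split_ifs with h
    · simp [h]
    · rfl
  have i2 : (if impliedProb μ f (b1, b2) = 1 then 0
      else κ * (1 - q) / (1 - impliedProb μ f (b1, b2)))
      = κ * (1 - q) / (1 - impliedProb μ f (b1, b2)) := by
    split_ifs with h
    · simp [h]
    · rfl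
  unfold payoff VV
  rw [i1, i2, hP', hP, div_div_eq_mul_div, div_div_eq_mul_div]

/-- If both unit profits are negative, an optimal diffuse player does not bet. -/
lemma diffuse_zero (A B x y : ℝ) (hA : A < 0) (hB : B < 0) (hx : 0 ≤ x) (hy : 0 ≤ y)
    (h : x * A + y * B = sSup {z | ∃ b1 b2 : ℝ, 0 ≤ b1 ∧ 0 ≤ b2 ∧ b1 + b2 ≤ 1 ∧
        z = b1 * A + b2 * B}) : x = 0 ∧ y = 0 := by
  have h0 : 0 ≤ x * A + y * B := by
    rw [h]
    refine le_csSup ⟨0, ?_⟩ ⟨0, 0, le_rfl, le_rfl, by norm_num, by ring⟩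
    rintro z ⟨b1, b2, hb1, hb2, -, rfl⟩
    have := mul_nonpos_of_nonneg_of_nonpos hb1 hA.le
    have := mul_nonpos_of_nonneg_of_nonpos hb2 hB.le
    linarith
  have p1 := mul_nonpos_of_nonneg_of_nonpos hx hA.le
  have p2 := mul_nonpos_of_nonneg_of_nonpos hy hB.le
  constructor
  · have : x * A = 0 := by linarith
    exact (mul_eq_zero.1 this).resolve_right hA.ne
  · have : y * B = 0 := by linarith
    exact (mul_eq_zero.1 this).resolve_right hB.ne

/-- Corollary: the atomic player wagers on an outcome if and only if her final
expected profit per unit bet on that outcome is positive. -/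
theorem stmt_9 (κ q w : ℝ) (hκ : κ ∈ Ioo (0:ℝ) 1) (hq : q ∈ Icc (0:ℝ) 1) (hw : 0 < w)
    (μ : Measure ℝ) (hμ : NiceDensity μ)
    (f : ℝ → ℝ × ℝ) (a : ℝ × ℝ) (h : IsEquilibrium κ q w μ f a) :
    (0 < a.1 ↔ κ * q > impliedProb μ f a) ∧
      (0 < a.2 ↔ κ * (1 - q) > 1 - impliedProb μ f a) := by
  obtain ⟨hf, ⟨ha1, ha2, haw⟩, hT, hdiff, hat⟩ := h
  obtain ⟨a1, a2⟩ := a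
  simp only at ha1 ha2 haw hT hat ⊢
  have hk1 : 0 ≤ κ * q := mul_nonneg hκ.1.le hq.1
  have hk2 : 0 ≤ κ * (1 - q) := mul_nonneg hκ.1.le (by linarith [hq.2])
  have hk : κ * q + κ * (1 - q) < 1 := by
    have : κ * q + κ * (1 - q) = κ := by ring
    linarith [hκ.2]
  have hd1 : 0 ≤ d1 μ f := setIntegral_nonneg measurableSet_Icc fun p hp => (hf.2 p hp).1
  have hd2 : 0 ≤ d2 μ f := setIntegral_nonneg measurableSet_Icc fun p hp => (hf.2 p hp).2.1
  have hopt : ∀ b1 b2 : ℝ, 0 ≤ b1 → 0 ≤ b2 → b1 + b2 ≤ w → 0 < d1 μ f + d2 μ f + b1 + b2 →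
      VV (d1 μ f) (d2 μ f) (κ * q) (κ * (1 - q)) b1 b2 ≤
      VV (d1 μ f) (d2 μ f) (κ * q) (κ * (1 - q)) a1 a2 := by
    intro b1 b2 hb1 hb2 hb hTb
    rw [← payoff_eq κ q μ f a1 a2 hT, hat]
    refine le_csSup ⟨(κ * q + κ * (1 - q)) * (d1 μ f + d2 μ f + w), ?_⟩
      ⟨b1, b2, hb1, hb2, hb, hTb, (payoff_eq κ q μ f b1 b2 hTb).symm⟩
    rintro z ⟨c1, c2, hc1, hc2, hc, hTc, rfl⟩
    rw [payoff_eq κ q μ f c1 c2 hTc]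
    exact VV_le _ _ _ _ _ _ _ hd1 hd2 hk1 hk2 hc1 hc2 hc
  have hopt' : ∀ b1 b2 : ℝ, 0 ≤ b1 → 0 ≤ b2 → b1 + b2 ≤ w → 0 < d2 μ f + d1 μ f + b1 + b2 →
      VV (d2 μ f) (d1 μ f) (κ * (1 - q)) (κ * q) b1 b2 ≤
      VV (d2 μ f) (d1 μ f) (κ * (1 - q)) (κ * q) a2 a1 := by
    intro b1 b2 hb1 hb2 hb hTb
    rw [VV_swap (d1 μ f) (d2 μ f) (κ * q) (κ * (1 - q)) b2 b1,
      VV_swap (d1 μ f) (d2 μ f) (κ * q) (κ * (1 - q)) a1 a2]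
    exact hopt b2 b1 hb2 hb1 (by linarith) (by linarith)
  have z1 : d1 μ f = 0 → a1 = 0 := by
    intro h0
    by_contra hne
    have hpos : 0 < a1 := lt_of_le_of_ne ha1 (Ne.symm hne)
    rw [h0] at hopt
    exact foc_zero _ _ _ a1 a2 w hd2 hk2 hk hpos ha2 haw hopt
  have z2 : d2 μ f = 0 → a2 = 0 := by
    intro h0
    by_contra hne
    have hpos : 0 < a2 := lt_of_le_of_ne ha2 (Ne.symm hne)
    rw [h0] at hopt'
    exact foc_zero _ _ _ a2 a1 w hd1 hk1 (by linarith) hpos ha1 (by linarith) hopt'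
  have hP : impliedProb μ f (a1, a2) = (d1 μ f + a1) / (d1 μ f + d2 μ f + a1 + a2) := rfl
  have y1 : d1 μ f ≠ 0 := by
    intro h0
    have h1 := z1 h0
    have hP0 : impliedProb μ f (a1, a2) = 0 := by rw [hP, h0, h1]; simp
    have hz : d2 μ f = 0 := by
      unfold d2
      refine setIntegral_eq_zero_of_forall_eq_zero fun p hp => ?_
      have hd := hdiff p hp
      rw [hP0] at hd
      simp only [payoff, if_true] at hd
      refine (diffuse_zero _ _ _ _ ?_ ?_ (hf.2 p hp).1 (hf.2 p hp).2.1 hd).2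
      · norm_num
      · norm_num
        nlinarith [hp.1, hκ.1, hκ.2, mul_nonneg hκ.1.le hp.1]
    have h2 := z2 hz
    rw [h0, h1, hz, h2] at hT
    norm_num at hT
  have y2 : d2 μ f ≠ 0 := by
    intro h0
    have h1 := z2 h0
    have hP0 : impliedProb μ f (a1, a2) = 1 := by
      rw [hP]
      rw [h0, h1] at hT ⊢
      rw [div_eq_one_iff_eq hT.ne']; ring
    have hz : d1 μ f = 0 := by
      unfold d1
      refine setIntegral_eq_zero_of_forall_eq_zero fun p hp => ?_
      have hd := hdiff p hp
      rw [hP0] at hd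
      simp only [payoff, if_true] at hd
      refine (diffuse_zero _ _ _ _ ?_ ?_ (hf.2 p hp).1 (hf.2 p hp).2.1 hd).1
      · norm_num
        nlinarith [hp.2, hκ.1, hκ.2]
      · norm_num
    exact y1 hz
  have p1 : 0 < d1 μ f := lt_of_le_of_ne hd1 (Ne.symm y1)
  have p2 : 0 < d2 μ f := lt_of_le_of_ne hd2 (Ne.symm y2)
  have c1 := core _ _ _ _ a1 a2 w p1 p2 hk1 hk2 hk ha1 ha2 haw hw hopt
  have c2 := core _ _ _ _ a2 a1 w p2 p1 hk2 hk1 (by linarith) ha2 ha1 (by linarith) hw hopt'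
  have hP' : 1 - impliedProb μ f (a1, a2) = (d2 μ f + a2) / (d1 μ f + d2 μ f + a1 + a2) := by
    rw [hP]; field_simp; ring
  have hTT : d2 μ f + d1 μ f + a2 + a1 = d1 μ f + d2 μ f + a1 + a2 := by ring
  rw [hTT] at c2
  constructor
  · rw [c1, hP, gt_iff_lt, div_lt_iff₀ hT]
  · rw [c2, hP', gt_iff_lt, div_lt_iff₀ hT]
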